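/- Let q be an odd prime power, 1 ≤ d < m ≤ q, and f ∈ F_q[x] of degree 1 with f(0) ≠ 0 (e.g. f(x) = x + 1). Then the number N of d-f-Diophantine m-tuples satisfies N = q^m / (m! · 2^{binom(m,d)}) + O(q^{m-1}). -/

import Mathlib

open Polynomial

section Stepanov

variable {F : Type*} [Field F]

theorem pow_sub_dvd_hasseDeriv_pow (f : F[X]) (n k : ℕ) :
    f ^ (n - k) ∣ hasseDeriv k (f ^ n) := by
  induction n generalizing k with
  | zero => simp
  | succ n ih =>
    rw [pow_succ', hasseDeriv_mul]
    refine Finset.dvd_sum fun ij hij => ?_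
    rw [Finset.HasAntidiagonal.mem_antidiagonal] at hij
    rcases Nat.eq_zero_or_pos ij.1 with h | h
    · rw [h, hasseDeriv_zero']
      have hk : ij.2 = k := by omega
      rw [hk]
      refine (pow_dvd_pow f (by omega : n + 1 - k ≤ (n - k) + 1)).trans ?_
      rw [pow_succ']
      exact mul_dvd_mul_left f (ih k)
    · exact ((pow_dvd_pow f (by omega : n + 1 - k ≤ n - ij.2)).trans (ih ij.2)).mul_left _

theorem pow_sub_dvd_hasseDeriv_pow_mul (f r : F[X]) (n k : ℕ) :
    f ^ (n - k) ∣ hasseDeriv k (f ^ n * r) := by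
  rw [hasseDeriv_mul]
  refine Finset.dvd_sum fun ij hij => ?_
  rw [Finset.HasAntidiagonal.mem_antidiagonal] at hij
  exact ((pow_dvd_pow f (by omega : n - k ≤ n - ij.1)).trans
    (pow_sub_dvd_hasseDeriv_pow f n ij.1)).mul_right _

/-- The quotient of `hasseDeriv k (f ^ n * r)` by `f ^ (n - k)`, as a linear function of `r`. -/
theorem exists_linearMap_hasseDeriv_pow_mul {f : F[X]} (hf : f ≠ 0) (n k : ℕ) (hk : k ≤ n) :
    ∃ A : F[X] →ₗ[F] F[X], (∀ r, hasseDeriv k (f ^ n * r) = f ^ (n - k) * A r) ∧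
      ∀ D : ℕ, ∀ r ∈ degreeLT F D, A r ∈ degreeLT F (D + k * f.natDegree) := by
  obtain ⟨g, hg⟩ := LinearMap.exists_leftInverse_of_injective
    (LinearMap.mulLeft F (f ^ (n - k)))
    (LinearMap.ker_eq_bot.2 fun a b h => mul_left_cancel₀ (pow_ne_zero _ hf) h)
  have key : ∀ r, hasseDeriv k (f ^ n * r) =
      f ^ (n - k) * (g ∘ₗ hasseDeriv k ∘ₗ LinearMap.mulLeft F (f ^ n)) r := by
    intro r
    obtain ⟨s, hs⟩ := pow_sub_dvd_hasseDeriv_pow_mul f r n k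
    have := LinearMap.congr_fun hg s
    simp only [LinearMap.comp_apply, LinearMap.mulLeft_apply, LinearMap.id_apply] at this ⊢
    rw [hs, this]
  refine ⟨_, key, fun D r hr => ?_⟩
  set A := g ∘ₗ hasseDeriv k ∘ₗ LinearMap.mulLeft F (f ^ n)
  by_cases hA : A r = 0
  · rw [hA]; exact Submodule.zero_mem _
  have hr0 : r ≠ 0 := by rintro rfl; exact hA (map_zero A)
  rw [mem_degreeLT, degree_eq_natDegree hr0, Nat.cast_lt] at hr
  rw [mem_degreeLT, degree_eq_natDegree hA, Nat.cast_lt]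
  have h1 := natDegree_hasseDeriv_le (f ^ n * r) k
  rw [key, natDegree_mul (pow_ne_zero _ hf) hA, natDegree_mul (pow_ne_zero _ hf) hr0,
    natDegree_pow, natDegree_pow] at h1
  obtain ⟨e, rfl⟩ := Nat.exists_eq_add_of_le hk
  rw [Nat.add_sub_cancel_left, add_mul] at h1
  omega

theorem X_sub_C_pow_dvd_of_hasseDeriv {P : F[X]} {x : F} {l : ℕ}
    (h : ∀ k < l, (hasseDeriv k P).eval x = 0) : (X - C x) ^ l ∣ P := by
  have h1 : X ^ l ∣ taylor x P := by
    rw [X_pow_dvd_iff]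
    intro k hk
    rw [taylor_coeff, h k hk]
  have h2 := map_dvd (taylorAlgHom (-x)) h1
  simpa [taylor_taylor, sub_eq_add_neg] using h2

theorem exists_ne_zero_forall_eq_zero {κ : Type*} [Fintype κ] (D M l : ℕ)
    (L : Fin l → (κ → F[X]) →ₗ[F] F[X])
    (hL : ∀ k v, (∀ i, v i ∈ degreeLT F D) → L k v ∈ degreeLT F M)
    (hlt : l * M < Fintype.card κ * D) :
    ∃ v : κ → F[X], v ≠ 0 ∧ (∀ i, v i ∈ degreeLT F D) ∧ ∀ k, L k v = 0 := by
  let ι : (κ → degreeLT F D) →ₗ[F] (κ → F[X]) :=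
    LinearMap.pi fun i => (degreeLT F D).subtype ∘ₗ LinearMap.proj i
  let T : (κ → degreeLT F D) →ₗ[F] (Fin l × Fin M → F) :=
    LinearMap.pi fun km => lcoeff F km.2 ∘ₗ L km.1 ∘ₗ ι
  have hfin : Module.finrank F (degreeLT F D) = D := by
    rw [(degreeLTEquiv F D).finrank_eq, Module.finrank_fin_fun]
  have : Module.Finite F (degreeLT F D) := Module.Finite.equiv (degreeLTEquiv F D).symm
  have hT : LinearMap.ker T ≠ ⊥ := by
    apply LinearMap.ker_ne_bot_of_finrank_lt
    rw [Module.finrank_fintype_fun_eq_card, Module.finrank_pi_fintype]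
    simpa [hfin] using hlt
  obtain ⟨v, hv, hv0⟩ := Submodule.exists_mem_ne_zero_of_ne_bot hT
  refine ⟨ι v, ?_, fun i => (v i).2, fun k => ?_⟩
  · intro h
    apply hv0
    funext i
    exact Subtype.ext (congrFun h i)
  · have hd := hL k (ι v) fun i => (v i).2
    ext m
    rw [coeff_zero]
    by_cases hm : m < M
    · have := congrFun (LinearMap.mem_ker.1 hv) (k, ⟨m, hm⟩)
      simpa [T] using this
    · rw [mem_degreeLT] at hd
      exact coeff_eq_zero_of_degree_lt (hd.trans_le (by exact_mod_cast not_lt.1 hm))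

variable [Fintype F]

theorem pow_card_sub_C (g : F[X]) (x : F) :
    g ^ Fintype.card F - C x = (g - C x) ^ Fintype.card F := by
  obtain ⟨p, _⟩ := CharP.exists F
  obtain ⟨n, hp, hn⟩ := FiniteField.card F p
  have := Fact.mk hp
  have : ExpChar F p := ExpChar.prime hp
  have h := sub_pow_expChar_pow (p := p) g (C x) n
  rw [← hn, ← C_pow, FiniteField.pow_card] at h
  exact h.symm

theorem eq_zero_of_sum_X_pow_card_mul {f : F[X]} (h0 : f.eval 0 = 1)
    (hns : ∀ r s : F[X], r ^ 2 * f = s ^ 2 → r = 0) {c D : ℕ} (hc : Fintype.card F = 2 * c + 1)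
    (hD : 2 * D + f.natDegree ≤ Fintype.card F) (J : ℕ) (r s : ℕ → F[X])
    (hr : ∀ j, r j ∈ degreeLT F D) (hs : ∀ j, s j ∈ degreeLT F D)
    (h : ∑ j ∈ Finset.range J, (r j + s j * f ^ c) * X ^ (j * Fintype.card F) = 0) :
    ∀ j < J, r j = 0 ∧ s j = 0 := by
  set q := Fintype.card F with hq
  have base : ∀ u v : F[X], u ∈ degreeLT F D → v ∈ degreeLT F D → X ^ q ∣ u + v * f ^ c →
      u = 0 ∧ v = 0 := by
    intro u v hu hv hdvd
    have e1 : X ^ q ∣ f ^ q - C 1 := by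
      rw [hq, pow_card_sub_C]
      apply pow_dvd_pow_of_dvd
      rw [X_dvd_iff, coeff_zero_eq_eval_zero]
      simp [h0]
    have e2 : X ^ q ∣ u ^ 2 * f - v ^ 2 := by
      have : u ^ 2 * f - v ^ 2 =
          (u + v * f ^ c) * ((u - v * f ^ c) * f) + v ^ 2 * (f ^ q - C 1) := by
        rw [hc, C_1]; ring
      rw [this]
      exact dvd_add (hdvd.mul_right _) (e1.mul_left _)
    have hq0 : 0 < q := Fintype.card_pos
    have nd : ∀ w : F[X], w ∈ degreeLT F D → w = 0 ∨ w.natDegree < D := by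
      intro w hw
      by_cases hw0 : w = 0
      · exact Or.inl hw0
      · rw [mem_degreeLT, degree_eq_natDegree hw0, Nat.cast_lt] at hw
        exact Or.inr hw
    have d1 : (u ^ 2 * f).degree < (q : ℕ) := by
      rcases nd u hu with rfl | hu'
      · simp
      · refine lt_of_le_of_lt degree_le_natDegree ?_
        have := natDegree_mul_le (p := u ^ 2) (q := f)
        have := natDegree_pow_le (p := u) (n := 2)
        exact_mod_cast (by omega : (u ^ 2 * f).natDegree < q)
    have d2 : (v ^ 2).degree < (q : ℕ) := by
      rcases nd v hv with rfl | hv'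
      · simp
      · refine lt_of_le_of_lt degree_le_natDegree ?_
        have := natDegree_pow_le (p := v) (n := 2)
        exact_mod_cast (by omega : (v ^ 2).natDegree < q)
    have e3 : u ^ 2 * f - v ^ 2 = 0 := by
      refine eq_zero_of_dvd_of_degree_lt e2 ?_
      rw [degree_X_pow]
      exact lt_of_le_of_lt (degree_sub_le _ _) (max_lt d1 d2)
    have hu0 := hns u v (sub_eq_zero.1 e3)
    refine ⟨hu0, ?_⟩
    rw [hu0] at e3
    simpa using e3
  intro j
  induction j using Nat.strong_induction_on with
  | _ j ih =>
    intro hj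
    apply base _ _ (hr j) (hs j)
    have h1 : X ^ (j * q) * X ^ q ∣ (r j + s j * f ^ c) * X ^ (j * q) := by
      have : (r j + s j * f ^ c) * X ^ (j * q) =
          - ∑ i ∈ (Finset.range J).erase j, (r i + s i * f ^ c) * X ^ (i * q) := by
        rw [eq_neg_iff_add_eq_zero, ← h]
        exact Finset.add_sum_erase _ (fun j => (r j + s j * f ^ c) * X ^ (j * q))
          (Finset.mem_range.2 hj)
      rw [this, dvd_neg]
      refine Finset.dvd_sum fun i hi => ?_
      rw [Finset.mem_erase, Finset.mem_range] at hi
      rcases lt_or_gt_of_ne hi.1 with hlt | hlt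
      · obtain ⟨a, b⟩ := ih i hlt hi.2
        simp [a, b]
      · refine Dvd.dvd.mul_left ?_ _
        rw [← pow_add]
        exact pow_dvd_pow _ (by nlinarith)
    rw [mul_comm (r j + s j * f ^ c)] at h1
    exact (mul_dvd_mul_iff_left (pow_ne_zero _ X_ne_zero)).1 h1

omit [Fintype F] in
theorem card_mul_le_natDegree_of_X_sub_C_pow_dvd {P : F[X]} (hP : P ≠ 0) {l : ℕ} (S : Finset F)
    (h : ∀ x ∈ S, (X - C x) ^ l ∣ P) : S.card * l ≤ P.natDegree := by
  have h1 : ∏ x ∈ S, (X - C x) ^ l ∣ P := by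
    refine Finset.prod_dvd_of_coprime (fun x _ y _ hxy => ?_) h
    exact (pairwise_coprime_X_sub_C Function.injective_id hxy).pow
  have h2 := natDegree_le_of_dvd h1 hP
  rw [natDegree_prod_of_monic _ _ fun x _ => (monic_X_sub_C x).pow l] at h2
  simpa [natDegree_pow] using h2

theorem card_mul_le_of_stepanov {f : F[X]} (h0 : f.eval 0 = 1)
    (hns : ∀ r s : F[X], r ^ 2 * f = s ^ 2 → r = 0) {c D J l : ℕ}
    (hc : Fintype.card F = 2 * c + 1) (hD : 2 * D + f.natDegree ≤ Fintype.card F)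
    (hl : l ≤ Fintype.card F) (hlt : l * (D + l * f.natDegree + J) < 2 * J * D)
    (a : F) (S : Finset F) (hS : ∀ x ∈ S, f.eval x ^ c = a) :
    S.card * l ≤ l * f.natDegree + c * f.natDegree + D + J * Fintype.card F := by
  have hf : f ≠ 0 := by rintro rfl; simp at h0
  choose A hA hA' using fun k : Fin l => exists_linearMap_hasseDeriv_pow_mul hf l k k.2.le
  choose B hB hB' using fun k : Fin l =>
    exists_linearMap_hasseDeriv_pow_mul hf (l + c) k (k.2.le.trans (Nat.le_add_right _ _))
  let L : Fin l → (Bool × Fin J → F[X]) →ₗ[F] F[X] := fun k =>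
    ∑ j : Fin J, LinearMap.mulLeft F (X ^ (j : ℕ)) ∘ₗ
      (A k ∘ₗ LinearMap.proj (false, j) + a • (B k ∘ₗ LinearMap.proj (true, j)))
  have Ldef : ∀ k v, L k v =
      ∑ j : Fin J, X ^ (j : ℕ) * (A k (v (false, j)) + a • B k (v (true, j))) := by
    intro k v
    simp [L, LinearMap.sum_apply]
  obtain ⟨v, hv0, hvD, hvL⟩ := exists_ne_zero_forall_eq_zero (κ := Bool × Fin J) D
    (D + l * f.natDegree + J) l L (by
      intro k v hv
      rw [Ldef]
      refine Submodule.sum_mem _ fun j _ => ?_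
      have h1 : A k (v (false, j)) + a • B k (v (true, j)) ∈
          degreeLT F (D + k * f.natDegree) :=
        Submodule.add_mem _ (hA' k D _ (hv _)) (Submodule.smul_mem _ _ (hB' k D _ (hv _)))
      generalize A k (v (false, j)) + a • B k (v (true, j)) = w at h1
      by_cases hw : w = 0
      · simp [hw]
      rw [mem_degreeLT, degree_eq_natDegree hw, Nat.cast_lt] at h1
      rw [mem_degreeLT, degree_mul, degree_X_pow, degree_eq_natDegree hw]
      have := Nat.mul_le_mul_right f.natDegree k.2.le
      have := j.2
      exact_mod_cast (by omega : (j : ℕ) + w.natDegree < D + l * f.natDegree + J))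
    (by simpa [mul_assoc] using hlt)
  let r : ℕ → F[X] := fun j => if h : j < J then v (false, ⟨j, h⟩) else 0
  let s : ℕ → F[X] := fun j => if h : j < J then v (true, ⟨j, h⟩) else 0
  have hr : ∀ j, r j ∈ degreeLT F D := by
    intro j
    by_cases h : j < J
    · simp only [r, h, dif_pos]; exact hvD _
    · simp only [r, h, dif_neg, not_false_iff]; exact Submodule.zero_mem _
  have hs : ∀ j, s j ∈ degreeLT F D := by
    intro j
    by_cases h : j < J
    · simp only [s, h, dif_pos]; exact hvD _
    · simp only [s, h, dif_neg, not_false_iff]; exact Submodule.zero_mem _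
  have hvL' : ∀ k : Fin l, ∑ j ∈ Finset.range J, X ^ j * (A k (r j) + a • B k (s j)) = 0 := by
    intro k
    rw [← hvL k, Ldef, ← Fin.sum_univ_eq_sum_range (fun j => X ^ j * (A k (r j) + a • B k (s j)))]
    simp [r, s]
  set q := Fintype.card F with hq
  set Q : F[X] := ∑ j ∈ Finset.range J, (r j + s j * f ^ c) * X ^ (j * q) with hQ
  have hQ0 : Q ≠ 0 := by
    intro h
    have := eq_zero_of_sum_X_pow_card_mul h0 hns hc hD J r s hr hs h
    apply hv0
    funext ⟨b, j⟩
    obtain ⟨h1, h2⟩ := this j j.2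
    cases b
    · simpa [r] using h1
    · simpa [s] using h2
  have hP0 : f ^ l * Q ≠ 0 := mul_ne_zero (pow_ne_zero _ hf) hQ0
  refine (card_mul_le_natDegree_of_X_sub_C_pow_dvd hP0 S fun x hx => ?_).trans ?_
  · set G : F[X] := ∑ j ∈ Finset.range J, C (x ^ j) * (f ^ l * r j + f ^ (l + c) * s j) with hG
    have h1 : (X - C x) ^ l ∣ f ^ l * Q - G := by
      have : f ^ l * Q - G = ∑ j ∈ Finset.range J,
          (f ^ l * r j + f ^ (l + c) * s j) * ((X ^ q) ^ j - C x ^ j) := by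
        rw [hQ, hG, Finset.mul_sum, ← Finset.sum_sub_distrib]
        refine Finset.sum_congr rfl fun j _ => ?_
        rw [C_pow, mul_comm j q, pow_mul, pow_add]
        ring
      rw [this]
      refine Finset.dvd_sum fun j _ => Dvd.dvd.mul_left ?_ _
      refine dvd_trans ?_ (sub_dvd_pow_sub_pow _ _ _)
      rw [hq, pow_card_sub_C]
      exact pow_dvd_pow _ hl
    have h2 : (X - C x) ^ l ∣ G := by
      refine X_sub_C_pow_dvd_of_hasseDeriv fun k hk => ?_
      have h3 := congrArg (fun w => f.eval x ^ (l - k) * eval x w) (hvL' ⟨k, hk⟩)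
      simp only [eval_zero, mul_zero] at h3
      rw [← h3, hG, map_sum, eval_finsetSum, eval_finsetSum, Finset.mul_sum]
      refine Finset.sum_congr rfl fun j _ => ?_
      have e1 := hA ⟨k, hk⟩ (r j)
      have e2 := hB ⟨k, hk⟩ (s j)
      simp only at e1 e2
      rw [← smul_eq_C_mul, map_smul, map_add, e1, e2]
      have e3 : l + c - k = (l - k) + c := by omega
      simp only [eval_smul, eval_add, eval_mul, eval_pow, eval_X, smul_eq_mul, e3, pow_add, hS x hx]
      ring
    have := dvd_add h1 h2
    rwa [sub_add_cancel] at this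
  · have nd : ∀ w : F[X], w ∈ degreeLT F D → w.natDegree ≤ D := by
      intro w hw
      by_cases hw0 : w = 0
      · simp [hw0]
      · rw [mem_degreeLT, degree_eq_natDegree hw0, Nat.cast_lt] at hw
        exact hw.le
    have hQd : Q.natDegree ≤ c * f.natDegree + D + J * q := by
      refine natDegree_sum_le_of_forall_le _ _ fun j hj => ?_
      rw [Finset.mem_range] at hj
      refine natDegree_mul_le.trans ?_
      rw [natDegree_X_pow]
      have t1 : (r j + s j * f ^ c).natDegree ≤ c * f.natDegree + D := by
        refine natDegree_add_le_of_degree_le ((nd _ (hr j)).trans (by omega)) ?_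
        refine natDegree_mul_le.trans ?_
        have := nd _ (hs j)
        have := natDegree_pow_le (p := f) (n := c)
        omega
      have t2 : j * q ≤ J * q := Nat.mul_le_mul_right _ hj.le
      omega
    refine natDegree_mul_le.trans ?_
    have := natDegree_pow_le (p := f) (n := l)
    omega

end Stepanov

section CharacterSum

variable {F : Type*} [Field F] [Fintype F] [DecidableEq F]

theorem abs_quadraticChar_le_one (a : F) : |quadraticChar F a| ≤ 1 := by
  by_cases ha : a = 0
  · simp [ha]
  · rcases quadraticChar_dichotomy ha with h | h <;> simp [h]

theorem abs_sum_quadraticChar_le_card {α : Type*} (s : Finset α) (g : α → F) :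
    |∑ x ∈ s, quadraticChar F (g x)| ≤ s.card := by
  refine (Finset.abs_sum_le_sum_abs _ _).trans ?_
  refine (Finset.sum_le_sum fun x _ => abs_quadraticChar_le_one (g x)).trans ?_
  simp

omit [DecidableEq F] in
theorem two_mul_card_le_of_eval_pow_eq {f : F[X]} (h0 : f.eval 0 = 1)
    (hns : ∀ r s : F[X], r ^ 2 * f = s ^ 2 → r = 0) {N c : ℕ} (hN : f.natDegree ≤ N)
    (hc : Fintype.card F = 2 * c + 1) (hlarge : 8 * N + 8 ≤ Nat.sqrt (Fintype.card F))
    (a : F) (S : Finset F) (hS : ∀ x ∈ S, f.eval x ^ c = a) :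
    2 * S.card ≤ Fintype.card F + (29 * N + 27) * Nat.sqrt (Fintype.card F) := by
  set q := Fintype.card F with hq
  set h := Nat.sqrt q with hh
  have h1 : h * h ≤ q := Nat.sqrt_le q
  have h2 : q < (h + 1) * (h + 1) := Nat.lt_succ_sqrt q
  have hcN : N ≤ c := by nlinarith
  obtain ⟨D, hD⟩ := Nat.exists_eq_add_of_le hcN
  have hn := Nat.mul_le_mul_left h hN
  have key := card_mul_le_of_stepanov h0 hns (c := c) (D := D) (J := h + (8 * N + 8)) (l := 2 * h)
    hc (by omega) (by nlinarith) (by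
      have e1 : 2 * h * (D + 2 * h * f.natDegree + (h + (8 * N + 8))) ≤
          2 * h * (D + 2 * (h * N) + (h + (8 * N + 8))) :=
        Nat.mul_le_mul_left _ (by nlinarith)
      refine lt_of_le_of_lt e1 ?_
      have e2 : h * (2 * (h * N) + (h + (8 * N + 8))) < (8 * N + 8) * D := by
        have e3 : 2 * D = q - 1 - 2 * N := by omega
        zify [(by omega : 1 ≤ q), (by omega : 2 * N ≤ q - 1)] at *
        nlinarith [mul_le_mul_of_nonneg_left hlarge (by positivity : (0 : ℤ) ≤ h),
          mul_le_mul_of_nonneg_left h1 (by positivity : (0 : ℤ) ≤ N),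
          mul_nonneg (by positivity : (0 : ℤ) ≤ N) (by positivity : (0 : ℤ) ≤ N),
          mul_le_mul_of_nonneg_left hlarge (by positivity : (0 : ℤ) ≤ N),
          mul_nonneg (mul_nonneg (by positivity : (0 : ℤ) ≤ N) (by positivity : (0 : ℤ) ≤ h))
            (sub_nonneg.2 hlarge)]
      nlinarith) a S hS
  have hpos : 0 < h := by omega
  have k1 : q ≤ 3 * (h * h) := by nlinarith
  have k2 := Nat.mul_le_mul_left c hN
  have k3 : (2 * S.card) * h ≤ (q + (29 * N + 27) * h) * h := by
    have k4 : 2 * (c * N + D) ≤ q * (N + 1) := by nlinarith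
    have k5 : (N + 1) * q ≤ (N + 1) * (3 * (h * h)) := Nat.mul_le_mul_left _ k1
    have k6 : h * N ≤ h * h * N := by nlinarith [Nat.zero_le (h * N)]
    nlinarith
  exact Nat.le_of_mul_le_mul_right k3 hpos

theorem abs_sum_quadraticChar_eval_le {f : F[X]} (h0 : f.eval 0 = 1)
    (hns : ∀ r s : F[X], r ^ 2 * f = s ^ 2 → r = 0) {N : ℕ} (hN : f.natDegree ≤ N)
    (hodd : Odd (Fintype.card F)) :
    |∑ x, quadraticChar F (f.eval x)| ≤ (8 * N + 8) ^ 2 * Nat.sqrt (Fintype.card F) := by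
  obtain ⟨c, hc⟩ := hodd
  have hq1 : 1 < Fintype.card F := Fintype.one_lt_card
  have hchar : ringChar F ≠ 2 := by
    intro h
    have := (FiniteField.even_card_iff_char_two (F := F)).1 h
    omega
  rcases lt_or_ge (Nat.sqrt (Fintype.card F)) (8 * N + 8) with hsmall | hlarge
  · refine (abs_sum_quadraticChar_le_card _ _).trans ?_
    rw [Finset.card_univ]
    have h1 := Nat.lt_succ_sqrt (Fintype.card F)
    have h2 : 0 < Nat.sqrt (Fintype.card F) := Nat.sqrt_pos.2 (by omega)
    have h3 : Fintype.card F ≤ (8 * N + 8) ^ 2 * Nat.sqrt (Fintype.card F) := by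
      have : (Nat.sqrt (Fintype.card F) + 1) * (Nat.sqrt (Fintype.card F) + 1) ≤
        (8 * N + 8) ^ 2 := by rw [sq]; exact Nat.mul_le_mul hsmall hsmall
      nlinarith
    exact_mod_cast h3
  have hpow : ∀ y : F, ((quadraticChar F y : ℤ) : F) = y ^ c := by
    intro y
    rw [quadraticChar_eq_pow_of_char_ne_two' hchar]
    congr 1
    omega
  have hP := two_mul_card_le_of_eval_pow_eq h0 hns hN hc hlarge 1
    (Finset.univ.filter fun x => quadraticChar F (f.eval x) = 1) (by
      intro x hx
      rw [← hpow, (Finset.mem_filter.1 hx).2, Int.cast_one])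
  have hM := two_mul_card_le_of_eval_pow_eq h0 hns hN hc hlarge (-1)
    (Finset.univ.filter fun x => quadraticChar F (f.eval x) = -1) (by
      intro x hx
      rw [← hpow, (Finset.mem_filter.1 hx).2, Int.cast_neg, Int.cast_one])
  have hZ : (Finset.univ.filter fun x => f.eval x = 0).card ≤ N := by
    have hf : f ≠ 0 := by rintro rfl; simp at h0
    refine le_trans ?_ ((card_roots' f).trans hN)
    refine le_trans (Finset.card_le_card ?_) (Multiset.toFinset_card_le f.roots)
    intro x hx
    rw [Multiset.mem_toFinset, mem_roots hf]
    exact (Finset.mem_filter.1 hx).2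
  have hsum : ∑ x, quadraticChar F (f.eval x) =
      ((Finset.univ.filter fun x => quadraticChar F (f.eval x) = 1).card : ℤ) -
        (Finset.univ.filter fun x => quadraticChar F (f.eval x) = -1).card := by
    rw [Finset.card_filter, Finset.card_filter]
    push_cast
    rw [← Finset.sum_sub_distrib]
    refine Finset.sum_congr rfl fun x _ => ?_
    by_cases hx : f.eval x = 0
    · simp [hx]
    · rcases quadraticChar_dichotomy hx with h | h <;> simp [h]
  have htot : (Fintype.card F : ℤ) =
      ((Finset.univ.filter fun x => quadraticChar F (f.eval x) = 1).card : ℤ) +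
        (Finset.univ.filter fun x => quadraticChar F (f.eval x) = -1).card +
        (Finset.univ.filter fun x => f.eval x = 0).card := by
    rw [Finset.card_filter, Finset.card_filter, Finset.card_filter, ← Finset.card_univ,
      Finset.card_eq_sum_ones]
    push_cast
    rw [← Finset.sum_add_distrib, ← Finset.sum_add_distrib]
    refine Finset.sum_congr rfl fun x _ => ?_
    by_cases hx : f.eval x = 0
    · simp [hx]
    · rcases quadraticChar_dichotomy hx with h | h <;> simp [h, hx]
  rw [hsum]
  set h := Nat.sqrt (Fintype.card F)
  have h1 : (1 : ℤ) ≤ h := by exact_mod_cast (by omega : 1 ≤ h)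
  have h2 : (N : ℤ) ≤ N * h := by nlinarith [Int.natCast_nonneg N]
  have h3 : (30 * N + 27 : ℤ) * h ≤ (8 * N + 8) ^ 2 * h := by
    refine mul_le_mul_of_nonneg_right ?_ (by omega)
    nlinarith [Int.natCast_nonneg N]
  zify at hP hM hZ
  rw [abs_le]
  constructor <;> nlinarith

omit [DecidableEq F] in
theorem eq_zero_of_sq_mul_prod_X_pow_eq_sq (hodd : Odd (Fintype.card F)) {ι : Type*}
    {s : Finset ι} (hs : s.Nonempty) (d : ℕ) (hd : 0 < d) (a : ι → F) (ha : Set.InjOn a s)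
    (ha0 : ∀ i ∈ s, a i ≠ 0) (r t : F[X]) (h : r ^ 2 * ∏ i ∈ s, (C (a i) * X ^ d + 1) = t ^ 2) :
    r = 0 := by
  induction d using Nat.strong_induction_on generalizing a r t with
  | _ d ih =>
  set g := ∏ i ∈ s, (C (a i) * X ^ d + 1) with hg
  by_cases hdF : (d : F) = 0
  · obtain ⟨p, _⟩ := CharP.exists F
    obtain ⟨n, hp, hn⟩ := FiniteField.card F p
    have := Fact.mk hp
    have : ExpChar F p := ExpChar.prime hp
    obtain ⟨e, rfl⟩ := (CharP.cast_eq_zero_iff F p d).1 hdF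
    have hpodd : Odd p := by
      rw [hn] at hodd
      exact (Nat.odd_pow_iff n.ne_zero).1 hodd
    have hfrob : Function.Bijective (frobenius F p) :=
      Finite.injective_iff_bijective.1 (frobenius F p).injective
    choose b hb using fun i => hfrob.2 (a i)
    simp only [frobenius_def] at hb
    have he : 0 < e := Nat.pos_of_mul_pos_left hd
    have hgp : g = (∏ i ∈ s, (C (b i) * X ^ e + 1)) ^ p := by
      rw [hg, ← Finset.prod_pow]
      refine Finset.prod_congr rfl fun i _ => ?_
      rw [add_pow_expChar, one_pow, mul_pow, ← C_pow, hb, ← pow_mul, mul_comm e p]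
    obtain ⟨k, hk⟩ := hpodd
    set w := ∏ i ∈ s, (C (b i) * X ^ e + 1) with hw
    have hw0 : w ≠ 0 := by
      intro h
      have := congrArg (eval 0) h
      rw [hw, eval_prod] at this
      simp [he.ne'] at this
    have := ih e (lt_mul_of_one_lt_left he hp.one_lt) he b
      (fun i hi j hj hij => ha hi hj (by rw [← hb, ← hb, hij]))
      (fun i hi hbi => ha0 i hi (by rw [← hb, hbi, zero_pow hp.ne_zero])) (r * w ^ k) t (by
        rw [← h, hgp, hk]; ring)
    exact (mul_eq_zero.1 this).resolve_right (pow_ne_zero _ hw0)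
  · have hsep : g.Separable := by
      refine separable_prod' (fun i hi j hj hij => ?_) fun i hi => ?_
      · have hne : a j - a i ≠ 0 := sub_ne_zero.2 fun h => hij (ha hi hj h.symm)
        refine ⟨C ((a j - a i)⁻¹ * a j), C (-((a j - a i)⁻¹ * a i)), ?_⟩
        have : C ((a j - a i)⁻¹ * a j) - C ((a j - a i)⁻¹ * a i) = (1 : F[X]) := by
          rw [← C_sub, ← mul_sub, inv_mul_cancel₀ hne, C_1]
        simp only [C_neg, C_mul] at this ⊢
        linear_combination this
      · have h1 : C (a i) * X ^ d + 1 = C (a i) * (X ^ d - C (-(a i)⁻¹)) := by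
          rw [mul_sub, ← C_mul, mul_neg, mul_inv_cancel₀ (ha0 i hi)]
          simp
        rw [h1]
        exact (separable_X_pow_sub_C _ hdF (neg_ne_zero.2 (inv_ne_zero (ha0 i hi)))).unit_mul
          (isUnit_C.2 (ha0 i hi).isUnit)
    by_contra hr
    have hdvd : r ∣ t := by
      rw [← UniqueFactorizationMonoid.pow_dvd_pow_iff_dvd two_ne_zero]
      exact ⟨g, h.symm⟩
    obtain ⟨u, rfl⟩ := hdvd
    have hgu : g = u * u := by
      apply mul_left_cancel₀ (pow_ne_zero 2 hr)
      rw [h]; ring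
    have hu : IsUnit u := hsep.squarefree u ⟨1, by rw [hgu, mul_one]⟩
    have hgunit : IsUnit g := hgu ▸ hu.mul hu
    obtain ⟨i, hi⟩ := hs
    have h2 := isUnit_of_dvd_unit (Finset.dvd_prod_of_mem (fun i => C (a i) * X ^ d + 1) hi) hgunit
    have h3 := natDegree_eq_zero_of_isUnit h2
    have h4 : (C (a i) * X ^ d + 1).natDegree = d := by
      rw [← C_1, natDegree_add_C, natDegree_C_mul_X_pow d _ (ha0 i hi)]
    omega

theorem abs_sum_units_quadraticChar_prod_le (hodd : Odd (Fintype.card F)) {ι : Type*}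
    {s : Finset ι} (hs : s.Nonempty) (d : ℕ) (hd : 0 < d) (a : ι → F) (ha : Set.InjOn a s)
    (ha0 : ∀ i ∈ s, a i ≠ 0) :
    |∑ u : Fˣ, ∏ i ∈ s, quadraticChar F (a i * (u : F) ^ d + 1)| ≤
      ((8 * (d * s.card) + 8) ^ 2 + 1) * Nat.sqrt (Fintype.card F) := by
  set f : F[X] := ∏ i ∈ s, (C (a i) * X ^ d + 1) with hf
  have heval : ∀ x, f.eval x = ∏ i ∈ s, (a i * x ^ d + 1) := by
    intro x
    rw [hf, eval_prod]
    simp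
  have h0 : f.eval 0 = 1 := by rw [heval]; simp [hd.ne']
  have hdeg : f.natDegree ≤ d * s.card := by
    rw [mul_comm, ← smul_eq_mul]
    refine (natDegree_prod_le _ _).trans (Finset.sum_le_card_nsmul _ _ _ fun i _ => ?_)
    rw [← C_1, natDegree_add_C]
    exact natDegree_C_mul_X_pow_le _ _
  have h1 := abs_sum_quadraticChar_eval_le h0
    (fun r t h => eq_zero_of_sq_mul_prod_X_pow_eq_sq hodd hs d hd a ha ha0 r t h) hdeg hodd
  have h2 : ∑ x, quadraticChar F (f.eval x) =
      1 + ∑ u : Fˣ, ∏ i ∈ s, quadraticChar F (a i * (u : F) ^ d + 1) := by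
    rw [← Finset.add_sum_erase _ _ (Finset.mem_univ (0 : F)), h0, map_one]
    congr 1
    symm
    refine Finset.sum_bij (fun u _ => (u : F)) (by simp) (fun u _ v _ h => Units.ext h)
      (fun b hb => ⟨Units.mk0 b (Finset.mem_erase.1 hb).1, by simp, rfl⟩) fun u _ => ?_
    rw [heval, map_prod]
  rw [h2] at h1
  have h3 : 0 < Nat.sqrt (Fintype.card F) := Nat.sqrt_pos.2 Fintype.card_pos
  zify at h3
  push_cast at h1
  rw [abs_le] at h1 ⊢
  constructor <;> nlinarith

end CharacterSum

section MonomialSum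

theorem card_le_pow_of_coordinate_determined {ι α : Type*} [Fintype ι] [DecidableEq ι] [Fintype α]
    (S : Finset (ι → α)) (j : ι)
    (h : ∀ x ∈ S, ∀ y ∈ S, (∀ i, i ≠ j → x i = y i) → x j = y j) :
    S.card ≤ Fintype.card α ^ (Fintype.card ι - 1) := by
  have h1 : Set.InjOn (fun (x : ι → α) (i : {i // i ≠ j}) => x i) S := by
    intro x hx y hy hxy
    have h2 : ∀ i, i ≠ j → x i = y i := fun i hi => congrFun hxy ⟨i, hi⟩
    funext i
    by_cases hi : i = j
    · subst hi; exact h x hx y hy h2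
    · exact h2 i hi
  classical
  have h2 := Finset.card_le_card_of_injOn (t := Finset.univ) _ (fun _ _ => Finset.mem_univ _) h1
  simpa [Fintype.card_subtype_compl] using h2

variable {F : Type*} [Field F] [Fintype F] [DecidableEq F] {ι : Type*} [Fintype ι] [DecidableEq ι]

theorem sum_units_quadraticChar_linear (hodd : Odd (Fintype.card F)) {a : F} (ha : a ≠ 0) :
    ∑ u : Fˣ, quadraticChar F (a * (u : F) + 1) = -1 := by
  have hchar : ringChar F ≠ 2 := by
    intro h
    have := (FiniteField.even_card_iff_char_two (F := F)).1 h
    rw [Nat.odd_iff] at hodd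
    omega
  have h1 : ∑ x : F, quadraticChar F (a * x + 1) = 0 := by
    rw [← quadraticChar_sum_zero hchar]
    exact Fintype.sum_equiv ((Equiv.mulLeft₀ a ha).trans (Equiv.addRight 1)) _ _ fun _ => rfl
  have h2 : ∑ x : F, quadraticChar F (a * x + 1) =
      1 + ∑ u : Fˣ, quadraticChar F (a * (u : F) + 1) := by
    rw [← Finset.add_sum_erase _ _ (Finset.mem_univ (0 : F))]
    congr 1
    · simp
    symm
    exact Finset.sum_bij (fun u _ => (u : F)) (by simp) (fun u _ v _ h => Units.ext h)
      (fun b hb => ⟨Units.mk0 b (Finset.mem_erase.1 hb).1, by simp, rfl⟩) fun u _ => rfl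
  omega

/-- Averaging over the torus that multiplies `∏ j ∈ T, x j` by `u` if `i ∈ T` and by `r ^ d`
otherwise. -/
theorem card_units_sq_mul_sum_prod_eq (𝒯 : Finset (Finset ι)) {d : ℕ}
    (h𝒯 : ∀ T ∈ 𝒯, T.card = d) (c : F) (i : ι) :
    (Fintype.card Fˣ : ℤ) ^ 2 * ∑ x : ι → Fˣ, ∏ T ∈ 𝒯, quadraticChar F (c * ∏ j ∈ T, (x j : F) + 1) =
      ∑ x : ι → Fˣ,
        (∑ u : Fˣ, ∏ T ∈ 𝒯.filter (i ∈ ·),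
          quadraticChar F ((c * ∏ j ∈ T, (x j : F)) * (u : F) ^ 1 + 1)) *
        ∑ r : Fˣ, ∏ T ∈ 𝒯.filter (i ∉ ·),
          quadraticChar F ((c * ∏ j ∈ T, (x j : F)) * (r : F) ^ d + 1) := by
  let w : Fˣ → Fˣ → ι → Fˣ := fun u r j => if j = i then u * (r ^ (d - 1))⁻¹ else r
  have hw : ∀ u r : Fˣ, ∀ T ∈ 𝒯, ∏ j ∈ T, (w u r j : F) = if i ∈ T then (u : F) else (r : F) ^ d := by
    intro u r T hT
    split_ifs with hi
    · rw [← Finset.mul_prod_erase _ _ hi, Finset.prod_congr rfl (g := fun _ => (r : F))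
        (fun j hj => by simp [w, (Finset.mem_erase.1 hj).1]), Finset.prod_const,
        Finset.card_erase_of_mem hi, h𝒯 T hT]
      simp [w]
    · rw [Finset.prod_congr rfl (g := fun _ => (r : F)) (fun j hj => by
        have : j ≠ i := by rintro rfl; exact hi hj
        simp [w, this]), Finset.prod_const, h𝒯 T hT]
  have h1 : ∀ u r : Fˣ, ∑ x : ι → Fˣ, ∏ T ∈ 𝒯, quadraticChar F (c * ∏ j ∈ T, (x j : F) + 1) =
      ∑ x : ι → Fˣ, (∏ T ∈ 𝒯.filter (i ∈ ·),
          quadraticChar F ((c * ∏ j ∈ T, (x j : F)) * (u : F) ^ 1 + 1)) *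
        ∏ T ∈ 𝒯.filter (i ∉ ·),
          quadraticChar F ((c * ∏ j ∈ T, (x j : F)) * (r : F) ^ d + 1) := by
    intro u r
    rw [← Equiv.sum_comp (Equiv.mulLeft (w u r))]
    refine Finset.sum_congr rfl fun x _ => ?_
    rw [← Finset.prod_filter_mul_prod_filter_not 𝒯 (i ∈ ·)]
    congr 1
    · refine Finset.prod_congr rfl fun T hT => ?_
      rw [Finset.mem_filter] at hT
      simp only [Equiv.coe_mulLeft, Pi.mul_apply, Units.val_mul, Finset.prod_mul_distrib]
      rw [hw u r T hT.1, if_pos hT.2]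
      congr 1; ring
    · refine Finset.prod_congr rfl fun T hT => ?_
      rw [Finset.mem_filter] at hT
      simp only [Equiv.coe_mulLeft, Pi.mul_apply, Units.val_mul, Finset.prod_mul_distrib]
      rw [hw u r T hT.1, if_neg hT.2]
      congr 1; ring
  have h2 := Finset.sum_congr (rfl : (Finset.univ : Finset Fˣ) = Finset.univ)
    fun u _ => Finset.sum_congr (rfl : (Finset.univ : Finset Fˣ) = Finset.univ) fun r _ => h1 u r
  rw [Finset.sum_const, Finset.sum_const, Finset.card_univ, nsmul_eq_mul, nsmul_eq_mul,
    ← mul_assoc, ← sq] at h2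
  rw [h2]
  simp_rw [Finset.sum_mul_sum]
  symm
  rw [Finset.sum_comm]
  exact Finset.sum_congr rfl fun u _ => Finset.sum_comm

theorem card_filter_not_injOn_le (𝒯 : Finset (Finset ι)) {d : ℕ} (h𝒯 : ∀ T ∈ 𝒯, T.card = d) :
    (Finset.univ.filter fun x : ι → Fˣ =>
      ¬ Set.InjOn (fun T => ∏ j ∈ T, (x j : F)) (𝒯 : Set (Finset ι))).card ≤
      𝒯.card ^ 2 * Fintype.card Fˣ ^ (Fintype.card ι - 1) := by
  have hsub : (Finset.univ.filter fun x : ι → Fˣ =>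
      ¬ Set.InjOn (fun T => ∏ j ∈ T, (x j : F)) (𝒯 : Set (Finset ι))) ⊆
      𝒯.offDiag.biUnion fun p => Finset.univ.filter fun x : ι → Fˣ =>
        ∏ j ∈ p.1, (x j : F) = ∏ j ∈ p.2, (x j : F) := by
    intro x hx
    rw [Finset.mem_filter] at hx
    simp only [Set.InjOn, not_forall] at hx
    obtain ⟨_, T, hT, T', hT', he, hne⟩ := hx
    rw [Finset.mem_biUnion]
    exact ⟨(T, T'), Finset.mem_offDiag.2 ⟨hT, hT', hne⟩, by simpa using he⟩
  refine (Finset.card_le_card hsub).trans ?_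
  refine (Finset.card_biUnion_le_card_mul _ _ (Fintype.card Fˣ ^ (Fintype.card ι - 1)) ?_).trans
    (Nat.mul_le_mul_right _ (by rw [Finset.offDiag_card, sq]; exact Nat.sub_le _ _))
  rintro ⟨T, T'⟩ hp
  obtain ⟨hT, hT', hne⟩ := Finset.mem_offDiag.1 hp
  obtain ⟨j, hj, hj'⟩ : ∃ j ∈ T, j ∉ T' := by
    by_contra! hcon
    exact hne (Finset.eq_of_subset_of_card_le hcon (by rw [h𝒯 _ hT, h𝒯 _ hT']))
  refine card_le_pow_of_coordinate_determined _ j fun x hx y hy hxy => ?_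
  have hx := (Finset.mem_filter.1 hx).2
  have hy := (Finset.mem_filter.1 hy).2
  simp only at hx hy
  rw [← Finset.mul_prod_erase _ _ hj] at hx hy
  have e1 : ∏ k ∈ T', (x k : F) = ∏ k ∈ T', (y k : F) := Finset.prod_congr rfl fun k hk => by
    rw [hxy k (by rintro rfl; exact hj' hk)]
  have e2 : ∏ k ∈ T.erase j, (x k : F) = ∏ k ∈ T.erase j, (y k : F) :=
    Finset.prod_congr rfl fun k hk => by rw [hxy k (Finset.mem_erase.1 hk).1]
  rw [e1, e2, ← hy] at hx
  exact Units.ext (mul_right_cancel₀ (Finset.prod_ne_zero_iff.2 fun k _ => (y k).ne_zero) hx)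

theorem abs_sum_prod_quadraticChar_le (hodd : Odd (Fintype.card F)) {𝒯 : Finset (Finset ι)}
    (hne : 𝒯.Nonempty) {d : ℕ} (hd : 0 < d) (h𝒯 : ∀ T ∈ 𝒯, T.card = d) {c : F} (hc : c ≠ 0) :
    |∑ x : ι → Fˣ, ∏ T ∈ 𝒯, quadraticChar F (c * ∏ j ∈ T, (x j : F) + 1)| ≤
      (2 * ((8 * (d * 𝒯.card) + 8) ^ 2 + 1) ^ 2 + 𝒯.card ^ 2 : ℕ) *
        (Fintype.card F : ℤ) ^ (Fintype.card ι - 1) := by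
  set K := (8 * (d * 𝒯.card) + 8) ^ 2 + 1 with hK
  have hmono : ∀ e ≤ d, ∀ 𝒰 ⊆ 𝒯, (8 * (e * 𝒰.card) + 8) ^ 2 + 1 ≤ K := fun e he 𝒰 h𝒰 => by
    have := Nat.mul_le_mul he (Finset.card_le_card h𝒰)
    rw [hK]
    gcongr
  have hQ : Fintype.card Fˣ + 1 = Fintype.card F := by
    rw [Fintype.card_units]
    have := Fintype.card_pos (α := F)
    omega
  have hq1 : 1 < Fintype.card F := Fintype.one_lt_card
  set Q := Fintype.card Fˣ with hQdef
  obtain ⟨T₀, hT₀⟩ := hne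
  obtain ⟨i, hi₀, hi⟩ : ∃ i ∈ T₀, (∃ T ∈ 𝒯, i ∉ T) ∨ 𝒯 = {T₀} := by
    by_cases h : ∃ T ∈ 𝒯, T ≠ T₀
    · obtain ⟨T, hT, hTne⟩ := h
      by_contra! hcon
      refine hTne (Finset.eq_of_subset_of_card_le (fun i hi => ?_)
        (by rw [h𝒯 _ hT, h𝒯 _ hT₀])).symm
      exact (hcon i hi).1 T hT
    · push Not at h
      obtain ⟨i, hi⟩ := Finset.card_pos.1 (by rw [h𝒯 _ hT₀]; exact hd)
      exact ⟨i, hi, Or.inr (Finset.eq_singleton_iff_unique_mem.2 ⟨hT₀, h⟩)⟩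
  have hιpos : 0 < Fintype.card ι := Fintype.card_pos_iff.2 ⟨i⟩
  set U : (ι → Fˣ) → ℤ := fun x => ∑ u : Fˣ, ∏ T ∈ 𝒯.filter (i ∈ ·),
          quadraticChar F ((c * ∏ j ∈ T, (x j : F)) * (u : F) ^ 1 + 1) with hU
  set V : (ι → Fˣ) → ℤ := fun x => ∑ r : Fˣ, ∏ T ∈ 𝒯.filter (i ∉ ·),
          quadraticChar F ((c * ∏ j ∈ T, (x j : F)) * (r : F) ^ d + 1) with hV
  have hUV : (Q : ℤ) ^ 2 * ∑ x : ι → Fˣ, ∏ T ∈ 𝒯, quadraticChar F (c * ∏ j ∈ T, (x j : F) + 1) =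
      ∑ x, U x * V x := card_units_sq_mul_sum_prod_eq 𝒯 h𝒯 c i
  have triv : ∀ (𝒰 : Finset (Finset ι)) (e : ℕ) (x : ι → Fˣ),
      |∑ u : Fˣ, ∏ T ∈ 𝒰, quadraticChar F ((c * ∏ j ∈ T, (x j : F)) * (u : F) ^ e + 1)| ≤ Q := by
    intro 𝒰 e x
    simp_rw [← map_prod]
    exact abs_sum_quadraticChar_le_card _ _
  have hprod : ∀ (x : ι → Fˣ) (T : Finset ι), c * ∏ j ∈ T, (x j : F) ≠ 0 := fun x T =>
    mul_ne_zero hc (Finset.prod_ne_zero_iff.2 fun j _ => (x j).ne_zero)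
  have hgood : ∀ x : ι → Fˣ, Set.InjOn (fun T => ∏ j ∈ T, (x j : F)) (𝒯 : Set (Finset ι)) →
      |U x * V x| ≤ 2 * (K : ℤ) ^ 2 * Q := by
    intro x hx
    have hQ1 : (1 : ℤ) ≤ Q := by omega
    have hK1 : (1 : ℤ) ≤ K := by rw [hK]; push_cast; nlinarith [sq_nonneg (8 * (d * 𝒯.card) + 8 : ℤ)]
    rcases hi with ⟨T₁, hT₁, hi₁⟩ | hi
    · have hx' : Set.InjOn (fun T => c * ∏ j ∈ T, (x j : F)) (𝒯 : Set (Finset ι)) :=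
        fun T hT T' hT' h => hx hT hT' (mul_left_cancel₀ hc h)
      have hs : (Nat.sqrt (Fintype.card F) : ℤ) * Nat.sqrt (Fintype.card F) ≤ 2 * Q := by
        have := Nat.sqrt_le (Fintype.card F)
        zify at this hQ hq1
        linarith
      have bU : |U x| ≤ K * Nat.sqrt (Fintype.card F) := by
        refine (abs_sum_units_quadraticChar_prod_le hodd ⟨T₀, Finset.mem_filter.2 ⟨hT₀, hi₀⟩⟩ 1
          one_pos _ (hx'.mono (Finset.coe_subset.2 (Finset.filter_subset _ _)))
          fun T _ => hprod x T).trans ?_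
        refine mul_le_mul_of_nonneg_right ?_ (Int.natCast_nonneg _)
        exact_mod_cast hmono 1 hd _ (Finset.filter_subset _ _)
      have bV : |V x| ≤ K * Nat.sqrt (Fintype.card F) := by
        refine (abs_sum_units_quadraticChar_prod_le hodd ⟨T₁, Finset.mem_filter.2 ⟨hT₁, hi₁⟩⟩ d
          hd _ (hx'.mono (Finset.coe_subset.2 (Finset.filter_subset _ _)))
          fun T _ => hprod x T).trans ?_
        refine mul_le_mul_of_nonneg_right ?_ (Int.natCast_nonneg _)
        exact_mod_cast hmono d le_rfl _ (Finset.filter_subset _ _)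
      rw [abs_mul]
      calc |U x| * |V x| ≤ (K * Nat.sqrt (Fintype.card F)) * (K * Nat.sqrt (Fintype.card F)) :=
            mul_le_mul bU bV (abs_nonneg _) (by positivity)
        _ = (K : ℤ) ^ 2 * (Nat.sqrt (Fintype.card F) * Nat.sqrt (Fintype.card F)) := by ring
        _ ≤ (K : ℤ) ^ 2 * (2 * Q) := mul_le_mul_of_nonneg_left hs (by positivity)
        _ = _ := by ring
    · have hU1 : U x = -1 := by
        rw [hU, hi]
        simp only [Finset.filter_singleton, hi₀, if_true, Finset.prod_singleton, pow_one]
        exact sum_units_quadraticChar_linear hodd (hprod x T₀)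
      rw [hU1, abs_mul, abs_neg, abs_one, one_mul]
      refine (triv _ d x).trans ?_
      have : (1 : ℤ) ≤ (K : ℤ) ^ 2 := one_le_pow₀ hK1
      nlinarith
  have hbad := card_filter_not_injOn_le (F := F) 𝒯 h𝒯
  rw [← hQdef] at hbad
  set bad := Finset.univ.filter fun x : ι → Fˣ =>
      ¬ Set.InjOn (fun T => ∏ j ∈ T, (x j : F)) (𝒯 : Set (Finset ι)) with hbaddef
  have hpt : ∀ x, |U x * V x| ≤ 2 * (K : ℤ) ^ 2 * Q + if x ∈ bad then (Q : ℤ) ^ 2 else 0 := by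
    intro x
    split_ifs with hx
    · rw [abs_mul, sq (Q : ℤ)]
      have := mul_le_mul (triv (𝒯.filter (i ∈ ·)) 1 x) (triv (𝒯.filter (i ∉ ·)) d x)
        (abs_nonneg _) (Int.natCast_nonneg _)
      have h2 : (0 : ℤ) ≤ 2 * (K : ℤ) ^ 2 * Q := by positivity
      linarith
    · rw [add_zero]
      exact hgood x (by simpa [hbaddef] using hx)
  have htotal : |∑ x, U x * V x| ≤
      (Q : ℤ) ^ 2 * ((2 * K ^ 2 + 𝒯.card ^ 2) * (Q : ℤ) ^ (Fintype.card ι - 1)) := by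
    refine (Finset.abs_sum_le_sum_abs _ _).trans ((Finset.sum_le_sum fun x _ => hpt x).trans ?_)
    rw [Finset.sum_add_distrib, Finset.sum_const, Finset.sum_ite_mem, Finset.univ_inter,
      Finset.sum_const, Finset.card_univ, Fintype.card_fun, ← hQdef, nsmul_eq_mul, nsmul_eq_mul]
    have h1 : (bad.card : ℤ) * (Q : ℤ) ^ 2 ≤
        𝒯.card ^ 2 * (Q : ℤ) ^ (Fintype.card ι - 1) * (Q : ℤ) ^ 2 :=
      mul_le_mul_of_nonneg_right (by exact_mod_cast hbad) (by positivity)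
    obtain ⟨k, hk⟩ := Nat.exists_eq_add_of_lt hιpos
    have hk1 : Fintype.card ι = k + 1 := by omega
    rw [hk1, Nat.add_sub_cancel] at h1 ⊢
    push_cast
    rw [pow_succ (Q : ℤ) k]
    linarith
  rw [← hUV, abs_mul, abs_of_nonneg (by positivity : (0 : ℤ) ≤ (Q : ℤ) ^ 2)] at htotal
  have hQ2 : (0 : ℤ) < (Q : ℤ) ^ 2 := by
    have : 0 < Q := by omega
    positivity
  refine (le_of_mul_le_mul_left htotal hQ2).trans ?_
  push_cast
  refine mul_le_mul_of_nonneg_left ?_ (by positivity)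
  exact pow_le_pow_left₀ (by positivity) (by omega) _

end MonomialSum

section Counting

theorem card_subsets_mul_factorial {F : Type*} [CommMonoid F] [Fintype F] [DecidableEq F]
    (m d : ℕ) (R : F → Prop) [DecidablePred R] :
    Nat.card {S : Finset F // S.card = m ∧ ∀ T ⊆ S, T.card = d → R (∏ x ∈ T, x)} * m.factorial =
      (Finset.univ.filter fun x : Fin m → F => Function.Injective x ∧
        ∀ T ∈ Finset.powersetCard d Finset.univ, R (∏ i ∈ T, x i)).card := by
  classical
  have hiff : ∀ x : Fin m → F, Function.Injective x →
      ((∀ T ∈ Finset.powersetCard d Finset.univ, R (∏ i ∈ T, x i)) ↔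
        ∀ T ⊆ Finset.univ.image x, T.card = d → R (∏ y ∈ T, y)) := by
    intro x hx
    constructor
    · intro h T hT hTd
      obtain ⟨U, _, rfl⟩ := Finset.subset_image_iff.1 hT
      rw [Finset.card_image_of_injective _ hx] at hTd
      rw [Finset.prod_image hx.injOn]
      exact h U (Finset.mem_powersetCard.2 ⟨Finset.subset_univ _, hTd⟩)
    · intro h T hT
      have := h (T.image x) (Finset.image_subset_image (Finset.subset_univ _))
        (by rw [Finset.card_image_of_injective _ hx, (Finset.mem_powersetCard.1 hT).2])
      rwa [Finset.prod_image hx.injOn] at this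
  rw [Nat.card_eq_fintype_card, Fintype.card_subtype]
  rw [Finset.card_eq_sum_card_fiberwise (f := fun x : Fin m → F => Finset.univ.image x)
    (t := Finset.univ.filter fun S : Finset F =>
      S.card = m ∧ ∀ T ⊆ S, T.card = d → R (∏ x ∈ T, x))]
  · rw [Finset.sum_const_nat (m := m.factorial)]
    intro S hS
    obtain ⟨hSm, hSR⟩ := (Finset.mem_filter.1 hS).2
    have e : Fin m ≃ S := (S.equivFinOfCardEq hSm).symm
    have hcard : (Finset.univ : Finset (Fin m ≃ S)).card = m.factorial := by
      rw [Finset.card_univ, Fintype.card_equiv e, Fintype.card_fin]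
    rw [← hcard]
    symm
    refine Finset.card_bij (fun σ _ i => (σ i : F)) (fun σ _ => ?_) (fun σ _ τ _ h => ?_)
      fun x hx => ?_
    · have hinj : Function.Injective fun i => (σ i : F) := Subtype.val_injective.comp σ.injective
      have himg : Finset.univ.image (fun i => (σ i : F)) = S := by
        ext y
        simp only [Finset.mem_image, Finset.mem_univ, true_and]
        constructor
        · rintro ⟨i, rfl⟩; exact (σ i).2
        · intro hy; exact ⟨σ.symm ⟨y, hy⟩, by simp⟩
      rw [Finset.mem_filter, Finset.mem_filter]
      exact ⟨⟨Finset.mem_univ _, hinj, (hiff _ hinj).2 (himg.symm ▸ hSR)⟩, himg⟩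
    · exact Equiv.ext fun i => Subtype.ext (congrFun h i)
    · rw [Finset.mem_filter, Finset.mem_filter] at hx
      obtain ⟨⟨_, hinj, _⟩, himg⟩ := hx
      have hmem : ∀ i, x i ∈ S := fun i => himg ▸ Finset.mem_image_of_mem x (Finset.mem_univ i)
      refine ⟨Equiv.ofBijective (fun i => (⟨x i, hmem i⟩ : S))
        ((Fintype.bijective_iff_injective_and_card _).2
          ⟨fun i j h => hinj (congrArg Subtype.val h), Fintype.card_congr e⟩),
        Finset.mem_univ _, rfl⟩
  · intro x hx
    obtain ⟨hinj, hR⟩ := (Finset.mem_filter.1 hx).2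
    simp only [Finset.coe_filter, Finset.mem_univ, true_and, Set.mem_ofPred_eq]
    exact ⟨by rw [Finset.card_image_of_injective _ hinj, Finset.card_univ, Fintype.card_fin],
      (hiff x hinj).1 hR⟩

variable {F : Type*} [Field F] [Fintype F] [DecidableEq F]

theorem card_injective_le_card_units_add (m : ℕ) (R : (Fin m → F) → Prop) [DecidablePred R] :
    (Finset.univ.filter fun x : Fin m → F => Function.Injective x ∧ R x).card ≤
      (Finset.univ.filter fun x : Fin m → Fˣ => R fun i => x i).card +
        m * Fintype.card F ^ (m - 1) := by
  have hsub : (Finset.univ.filter fun x : Fin m → F => Function.Injective x ∧ R x) ⊆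
      (Finset.univ.filter fun x : Fin m → Fˣ => R fun i => x i).image (fun x i => (x i : F)) ∪
        Finset.univ.biUnion fun j => Finset.univ.filter fun x : Fin m → F => x j = 0 := by
    intro x hx
    have hx := (Finset.mem_filter.1 hx).2.2
    by_cases h : ∃ j, x j = 0
    · obtain ⟨j, hj⟩ := h
      exact Finset.mem_union_right _ (Finset.mem_biUnion.2 ⟨j, Finset.mem_univ _, by simpa using hj⟩)
    · push Not at h
      exact Finset.mem_union_left _ (Finset.mem_image.2
        ⟨fun i => Units.mk0 (x i) (h i), by simpa using hx, by simp⟩)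
  refine (Finset.card_le_card hsub).trans ((Finset.card_union_le _ _).trans
    (Nat.add_le_add Finset.card_image_le ?_))
  refine (Finset.card_biUnion_le_card_mul _ _ (Fintype.card F ^ (m - 1)) fun j _ => ?_).trans
    (by simp)
  have := card_le_pow_of_coordinate_determined
    (Finset.univ.filter fun x : Fin m → F => x j = 0) j fun x hx y hy _ => by
      rw [(Finset.mem_filter.1 hx).2, (Finset.mem_filter.1 hy).2]
  simpa using this

theorem card_units_le_card_injective_add (m : ℕ) (R : (Fin m → F) → Prop) [DecidablePred R] :
    (Finset.univ.filter fun x : Fin m → Fˣ => R fun i => x i).card ≤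
      (Finset.univ.filter fun x : Fin m → F => Function.Injective x ∧ R x).card +
        m ^ 2 * Fintype.card F ^ (m - 1) := by
  have hinj : Function.Injective fun (x : Fin m → Fˣ) (i : Fin m) => (x i : F) :=
    fun x y h => funext fun i => Units.ext (congrFun h i)
  have hsub : (Finset.univ.filter fun x : Fin m → Fˣ => R fun i => x i).image
        (fun x i => (x i : F)) ⊆
      (Finset.univ.filter fun x : Fin m → F => Function.Injective x ∧ R x) ∪
        (Finset.univ : Finset (Fin m)).offDiag.biUnion fun p =>
          Finset.univ.filter fun x : Fin m → F => x p.1 = x p.2 := by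
    intro x hx
    obtain ⟨y, hy, rfl⟩ := Finset.mem_image.1 hx
    have hy := (Finset.mem_filter.1 hy).2
    by_cases h : Function.Injective fun i => (y i : F)
    · exact Finset.mem_union_left _ (Finset.mem_filter.2 ⟨Finset.mem_univ _, h, hy⟩)
    · simp only [Function.Injective, not_forall] at h
      obtain ⟨j, k, he, hne⟩ := h
      exact Finset.mem_union_right _ (Finset.mem_biUnion.2
        ⟨(j, k), by simpa using hne, by simpa using he⟩)
  rw [← Finset.card_image_of_injective _ hinj]
  refine (Finset.card_le_card hsub).trans ((Finset.card_union_le _ _).trans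
    (Nat.add_le_add_left ?_ _))
  refine (Finset.card_biUnion_le_card_mul _ _ (Fintype.card F ^ (m - 1)) ?_).trans
    (Nat.mul_le_mul_right _ ?_)
  · rintro ⟨j, k⟩ hp
    have hne : j ≠ k := (Finset.mem_offDiag.1 hp).2.2
    have := card_le_pow_of_coordinate_determined
      (Finset.univ.filter fun x : Fin m → F => x j = x k) j fun x hx y hy h => by
        rw [(Finset.mem_filter.1 hx).2, (Finset.mem_filter.1 hy).2, h k hne.symm]
    simpa using this
  · rw [Finset.offDiag_card, Finset.card_univ, Fintype.card_fin, sq]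
    exact Nat.sub_le _ _

theorem card_exists_eq_zero_le {m d : ℕ} (hd : 0 < d) {c : F} (hc : c ≠ 0)
    [DecidablePred fun x : Fin m → Fˣ => ∃ T ∈ Finset.powersetCard d Finset.univ,
      c * ∏ i ∈ T, (x i : F) + 1 = 0] :
    (Finset.univ.filter fun x : Fin m → Fˣ => ∃ T ∈ Finset.powersetCard d Finset.univ,
      c * ∏ i ∈ T, (x i : F) + 1 = 0).card ≤ m.choose d * Fintype.card F ^ (m - 1) := by
  have hsub : (Finset.univ.filter fun x : Fin m → Fˣ => ∃ T ∈ Finset.powersetCard d Finset.univ,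
      c * ∏ i ∈ T, (x i : F) + 1 = 0) ⊆
      (Finset.powersetCard d (Finset.univ : Finset (Fin m))).biUnion fun T =>
        Finset.univ.filter fun x : Fin m → Fˣ => c * ∏ i ∈ T, (x i : F) + 1 = 0 := by
    intro x hx
    rw [Finset.mem_filter] at hx
    obtain ⟨T, hT, h⟩ := hx.2
    exact Finset.mem_biUnion.2 ⟨T, hT, by simpa using h⟩
  refine (Finset.card_le_card hsub).trans ((Finset.card_biUnion_le_card_mul _ _
    (Fintype.card F ^ (m - 1)) fun T hT => ?_).trans (by simp))
  obtain ⟨j, hj⟩ := Finset.card_pos.1 (by rw [(Finset.mem_powersetCard.1 hT).2]; exact hd)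
  refine (card_le_pow_of_coordinate_determined _ j fun x hx y hy h => ?_).trans ?_
  · have hx := (Finset.mem_filter.1 hx).2
    have hy := (Finset.mem_filter.1 hy).2
    have hxy := mul_left_cancel₀ hc (add_right_cancel (hx.trans hy.symm))
    rw [← Finset.mul_prod_erase _ _ hj, ← Finset.mul_prod_erase _ (fun i => (y i : F)) hj,
      Finset.prod_congr rfl fun k hk => by rw [h k (Finset.mem_erase.1 hk).1]] at hxy
    exact Units.ext
      (mul_right_cancel₀ (Finset.prod_ne_zero_iff.2 fun k _ => (y k).ne_zero) hxy)
  · rw [Fintype.card_fin]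
    exact Nat.pow_le_pow_left (Fintype.card_units (α := F) ▸ Nat.sub_le _ _) _

theorem abs_indicator_sub_prod_le {κ : Type*} (P : Finset κ) (g : κ → F)
    [Decidable (∀ T ∈ P, IsSquare (g T))] [Decidable (∃ T ∈ P, g T = 0)] :
    |(if ∀ T ∈ P, IsSquare (g T) then (1 : ℝ) else 0) -
      ∏ T ∈ P, (1 + (quadraticChar F (g T) : ℝ)) / 2| ≤ if ∃ T ∈ P, g T = 0 then 1 else 0 := by
  split_ifs with h1 h2 h2
  all_goals try
    have hb : ∀ T ∈ P, 0 ≤ (1 + (quadraticChar F (g T) : ℝ)) / 2 ∧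
        (1 + (quadraticChar F (g T) : ℝ)) / 2 ≤ 1 := by
      intro T _
      have h : |((quadraticChar F (g T) : ℤ) : ℝ)| ≤ 1 := by
        exact_mod_cast abs_quadraticChar_le_one (g T)
      rw [abs_le] at h
      constructor <;> linarith
    have hb0 := Finset.prod_nonneg fun T hT => (hb T hT).1
    have hb1 := Finset.prod_le_one (fun T hT => (hb T hT).1) fun T hT => (hb T hT).2
  · rw [abs_le]; constructor <;> linarith
  · push Not at h2
    rw [Finset.prod_eq_one, sub_self, abs_zero]
    intro T hT
    rw [(quadraticChar_one_iff_isSquare (h2 T hT)).2 (h1 T hT)]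
    norm_num
  · rw [abs_le]; constructor <;> linarith
  · push Not at h1 h2
    obtain ⟨T, hT, hns⟩ := h1
    rw [Finset.prod_eq_zero hT, sub_self, abs_zero]
    rcases quadraticChar_dichotomy (h2 T hT) with h | h
    · exact absurd ((quadraticChar_one_iff_isSquare (h2 T hT)).1 h) hns
    · rw [h]; norm_num

theorem abs_sum_prod_sub_le (hodd : Odd (Fintype.card F)) {m d : ℕ} (hd : 0 < d) {b c : F}
    (hc : c ≠ 0) :
    |∑ x : Fin m → Fˣ, ∏ T ∈ Finset.powersetCard d Finset.univ,
        (1 + (quadraticChar F (b * (c * ∏ i ∈ T, (x i : F) + 1)) : ℝ)) / 2 -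
      (Fintype.card Fˣ : ℝ) ^ m / 2 ^ m.choose d| ≤
      (2 * ((8 * (d * m.choose d) + 8) ^ 2 + 1) ^ 2 + m.choose d ^ 2 : ℕ) *
        (Fintype.card F : ℝ) ^ (m - 1) := by
  set P := Finset.powersetCard d (Finset.univ : Finset (Fin m)) with hP
  have hPc : P.card = m.choose d := by simp [hP]
  set K : ℕ := 2 * ((8 * (d * m.choose d) + 8) ^ 2 + 1) ^ 2 + m.choose d ^ 2 with hK
  let W : Finset (Finset (Fin m)) → ℝ := fun 𝒯 => ∑ x : Fin m → Fˣ, ∏ T ∈ 𝒯,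
    (quadraticChar F (b * (c * ∏ i ∈ T, (x i : F) + 1)) : ℝ)
  have h1 : ∑ x : Fin m → Fˣ, ∏ T ∈ P,
        (1 + (quadraticChar F (b * (c * ∏ i ∈ T, (x i : F) + 1)) : ℝ)) / 2 =
      (∑ 𝒯 ∈ P.powerset, W 𝒯) / 2 ^ m.choose d := by
    simp_rw [Finset.prod_div_distrib, Finset.prod_one_add, Finset.prod_const, hPc]
    rw [← Finset.sum_div, Finset.sum_comm]
  have h2 : W ∅ = (Fintype.card Fˣ : ℝ) ^ m := by simp [W]
  have h3 : ∀ 𝒯 ∈ P.powerset.erase ∅, |W 𝒯| ≤ K * (Fintype.card F : ℝ) ^ (m - 1) := by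
    intro 𝒯 h𝒯
    rw [Finset.mem_erase, Finset.mem_powerset] at h𝒯
    have h𝒯d : ∀ T ∈ 𝒯, T.card = d := fun T hT => (Finset.mem_powersetCard.1 (h𝒯.2 hT)).2
    have key := abs_sum_prod_quadraticChar_le hodd (Finset.nonempty_iff_ne_empty.2 h𝒯.1) hd h𝒯d hc
    have h𝒯c : 𝒯.card ≤ m.choose d := hPc ▸ Finset.card_le_card h𝒯.2
    have hW : W 𝒯 = ((quadraticChar F b ^ 𝒯.card *
        ∑ x : Fin m → Fˣ, ∏ T ∈ 𝒯, quadraticChar F (c * ∏ j ∈ T, (x j : F) + 1) : ℤ) : ℝ) := by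
      simp only [W, map_mul, Finset.mul_sum, ← Finset.prod_const, ← Finset.prod_mul_distrib]
      push_cast
      rfl
    have hZle : |quadraticChar F b ^ 𝒯.card *
        ∑ x : Fin m → Fˣ, ∏ T ∈ 𝒯, quadraticChar F (c * ∏ j ∈ T, (x j : F) + 1)| ≤
        (K : ℤ) * (Fintype.card F : ℤ) ^ (m - 1) := by
      rw [abs_mul, abs_pow]
      refine (mul_le_of_le_one_left (abs_nonneg _)
        (pow_le_one₀ (abs_nonneg _) (abs_quadraticChar_le_one b))).trans (key.trans ?_)
      rw [Fintype.card_fin]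
      refine mul_le_mul_of_nonneg_right ?_ (by positivity)
      rw [hK]
      norm_cast
      gcongr
    rw [hW]
    exact_mod_cast hZle
  rw [h1, ← Finset.add_sum_erase _ _ (Finset.empty_mem_powerset P), h2, add_div,
    add_sub_cancel_left, abs_div, abs_of_pos (by positivity : (0 : ℝ) < 2 ^ m.choose d),
    div_le_iff₀ (by positivity)]
  refine (Finset.abs_sum_le_sum_abs _ _).trans ((Finset.sum_le_card_nsmul _ _ _ h3).trans ?_)
  rw [nsmul_eq_mul, mul_comm]
  refine mul_le_mul_of_nonneg_left ?_ (by positivity)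
  have := Finset.card_le_card (Finset.erase_subset ∅ P.powerset)
  rw [Finset.card_powerset, hPc] at this
  exact_mod_cast this

theorem card_pow_sub_card_units_pow_le (m : ℕ) :
    |(Fintype.card Fˣ : ℝ) ^ m - (Fintype.card F : ℝ) ^ m| ≤
      m * (Fintype.card F : ℝ) ^ (m - 1) := by
  have hQ : (Fintype.card F : ℝ) = Fintype.card Fˣ + 1 := by
    rw [Fintype.card_units]
    have := Fintype.card_pos (α := F)
    push_cast [Nat.cast_sub this]
    ring
  have h := abs_pow_sub_pow_le (Fintype.card Fˣ : ℝ) (Fintype.card F : ℝ) m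
  refine h.trans (le_of_eq ?_)
  have : max |(Fintype.card Fˣ : ℝ)| |(Fintype.card F : ℝ)| = Fintype.card F := by
    rw [Nat.abs_cast, Nat.abs_cast, max_eq_right]
    rw [hQ]; linarith
  rw [this]
  have : |(Fintype.card Fˣ : ℝ) - Fintype.card F| = 1 := by rw [hQ]; simp
  rw [this, one_mul]

end Counting

/-- main theorem, `deg f = 1`: for `f` of degree `1` with
`f(0) ≠ 0`, the number of `d`-`f`-Diophantine `m`-tuples in `F_q` is
`q^m/(m!·2^{binom(m,d)}) + O(q^{m-1})`. -/
theorem stmt_11 (m d : ℕ) (hd : 1 ≤ d) (hdm : d < m) :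
    ∃ C : ℝ, ∀ (F : Type) (_ : Field F) (_ : Fintype F) (_ : DecidableEq F),
      Odd (Fintype.card F) → m ≤ Fintype.card F →
      ∀ f : Polynomial F, f.natDegree = 1 → f.eval 0 ≠ 0 →
        |(Nat.card {S : Finset F // S.card = m ∧
              ∀ T ⊆ S, T.card = d → IsSquare (f.eval (∏ x ∈ T, x))} : ℝ)
            - (Fintype.card F : ℝ) ^ m /
                (Nat.factorial m * 2 ^ Nat.choose m d)|
          ≤ C * (Fintype.card F : ℝ) ^ (m - 1) := by
  obtain ⟨K, hK⟩ : ∃ K : ℕ, K =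
    2 * ((8 * (d * m.choose d) + 8) ^ 2 + 1) ^ 2 + m.choose d ^ 2 := ⟨_, rfl⟩
  refine ⟨(m + m ^ 2) + m.choose d + K + m, fun F _ _ _ hodd _ f hf1 hf0 => ?_⟩
  classical
  obtain ⟨a, b, rfl⟩ := exists_eq_X_add_C_of_natDegree_le_one hf1.le
  have hb : b ≠ 0 := by simpa using hf0
  have ha : a ≠ 0 := by
    rintro rfl
    simp at hf1
  have heval : ∀ z, (C a * X + C b).eval z = b * (a / b * z + 1) := by
    intro z
    simp only [eval_add, eval_mul, eval_C, eval_X]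
    field_simp
  have hc : a / b ≠ 0 := div_ne_zero ha hb
  simp_rw [heval]
  set c := a / b
  set N := Nat.card {S : Finset F // S.card = m ∧
    ∀ T ⊆ S, T.card = d → IsSquare (b * (c * ∏ x ∈ T, x + 1))} with hN
  have hNA := card_subsets_mul_factorial m d fun z : F => IsSquare (b * (c * z + 1))
  rw [← hN] at hNA
  set R : (Fin m → F) → Prop := fun x => ∀ T ∈ Finset.powersetCard d Finset.univ,
    IsSquare (b * (c * ∏ i ∈ T, x i + 1)) with hR
  have hAB := card_injective_le_card_units_add m R
  have hBA := card_units_le_card_injective_add m R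
  have hZ := card_exists_eq_zero_le (F := F) (m := m) hd hc
  have hmain := abs_sum_prod_sub_le (m := m) hodd hd (b := b) hc
  have hpow := card_pow_sub_card_units_pow_le (F := F) m
  have hind : |((Finset.univ.filter fun x : Fin m → Fˣ => R fun i => x i).card : ℝ) -
      ∑ x : Fin m → Fˣ, ∏ T ∈ Finset.powersetCard d Finset.univ,
        (1 + (quadraticChar F (b * (c * ∏ i ∈ T, (x i : F) + 1)) : ℝ)) / 2| ≤
      m.choose d * (Fintype.card F : ℝ) ^ (m - 1) := by
    rw [Finset.card_filter]
    push_cast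
    rw [← Finset.sum_sub_distrib]
    refine (Finset.abs_sum_le_sum_abs _ _).trans ((Finset.sum_le_sum fun x _ =>
      abs_indicator_sub_prod_le (Finset.powersetCard d Finset.univ)
        fun T => b * (c * ∏ i ∈ T, (x i : F) + 1)).trans ?_)
    simp only [mul_eq_zero, hb, false_or]
    rw [Finset.sum_boole]
    rw [← Nat.cast_pow, ← Nat.cast_mul]
    refine Nat.cast_le.2 (le_of_eq_of_le ?_ hZ)
    congr
  rw [← hK] at hmain
  have hA : (N : ℝ) * m.factorial = ((Finset.univ.filter fun x : Fin m → F =>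
      Function.Injective x ∧ R x).card : ℝ) := by
    rw [← Nat.cast_mul, hNA]
  set A := (Finset.univ.filter fun x : Fin m → F => Function.Injective x ∧ R x).card
  set B := (Finset.univ.filter fun x : Fin m → Fˣ => R fun i => x i).card
  clear_value A B N
  have hAB' : (A : ℝ) ≤ B + m * (Fintype.card F : ℝ) ^ (m - 1) := by exact_mod_cast hAB
  have hBA' : (B : ℝ) ≤ A + m ^ 2 * (Fintype.card F : ℝ) ^ (m - 1) := by exact_mod_cast hBA
  have h2 : (1 : ℝ) ≤ 2 ^ m.choose d := one_le_pow₀ one_le_two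
  have hpow' : |(Fintype.card Fˣ : ℝ) ^ m / 2 ^ m.choose d -
      (Fintype.card F : ℝ) ^ m / 2 ^ m.choose d| ≤ m * (Fintype.card F : ℝ) ^ (m - 1) := by
    rw [← sub_div, abs_div, abs_of_pos (by positivity : (0 : ℝ) < 2 ^ m.choose d)]
    exact (div_le_self (abs_nonneg _) h2).trans hpow
  have hfac : (1 : ℝ) ≤ m.factorial := by exact_mod_cast m.factorial_pos
  have hfinal : |(N : ℝ) * m.factorial - (Fintype.card F : ℝ) ^ m / 2 ^ m.choose d| ≤
      ((m + m ^ 2) + m.choose d + K + m) * (Fintype.card F : ℝ) ^ (m - 1) := by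
    rw [hA]
    have p1 : 0 ≤ (m : ℝ) * (Fintype.card F : ℝ) ^ (m - 1) := by positivity
    have p2 : 0 ≤ (m : ℝ) ^ 2 * (Fintype.card F : ℝ) ^ (m - 1) := by positivity
    simp only [add_mul]
    rw [abs_le] at hind hmain hpow' ⊢
    constructor <;> linarith
  have hdiv : (N : ℝ) - (Fintype.card F : ℝ) ^ m / (m.factorial * 2 ^ m.choose d) =
      (N * m.factorial - (Fintype.card F : ℝ) ^ m / 2 ^ m.choose d) / m.factorial := by
    field_simp
  rw [hdiv, abs_div, abs_of_pos (by linarith : (0 : ℝ) < m.factorial)]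
  exact (div_le_self (abs_nonneg _) hfac).trans hfinal
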